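/- Let R be an r × N complex matrix and let s > 0 be such that ‖y R‖₂ ≥ s‖y‖₂ for every row vector y ∈ ℂ^r (i.e., the smallest singular value of R is at least s). Let r ≤ n ≤ N and let S be a set of n column indices such that the r × n submatrix Â = R_{:,S} has nonzero volume (det(Â Âᴴ) ≠ 0) and has locally maximal volume with respect to single-column exchanges: for every j ∈ S and every i ∉ S, det(R_{:,(S\{j})∪{i}} (R_{:,(S\{j})∪{i}})ᴴ) ≤ det(Â Âᴴ). Then Â Âᴴ is invertible and trace((Â Âᴴ)^{-1}) ≤ (r + r(N−n)/(n−r+1)) / s²; equivalently, the Frobenius norm of the pseudoinverse satisfies ‖Â⁺‖_F ≤ ‖R⁺‖₂ √(r + r(N−n)/(n−r+1)). -/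

import Mathlib

open Matrix BigOperators

/-- The submatrix of `R` consisting of the columns indexed by the finite set `S`. -/
def colsSub {r N : ℕ} (R : Matrix (Fin r) (Fin N) ℂ) (S : Finset (Fin N)) :
    Matrix (Fin r) {x // x ∈ S} ℂ :=
  R.submatrix id (fun x : {x // x ∈ S} => (x : Fin N))

/-- The squared volume `det(B Bᴴ)` (a nonnegative real) of the column submatrix `R_{:,S}`. -/
noncomputable def sqVol {r N : ℕ} (R : Matrix (Fin r) (Fin N) ℂ) (S : Finset (Fin N)) : ℝ :=
  ((colsSub R S * (colsSub R S)ᴴ).det).re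

open scoped ComplexOrder

section

variable {r N : ℕ} (R : Matrix (Fin r) (Fin N) ℂ) (S : Finset (Fin N))

theorem colsSub_mul_conjTranspose_apply (a b : Fin r) :
    (colsSub R S * (colsSub R S)ᴴ) a b = ∑ k ∈ S, R a k * star (R b k) := by
  rw [Matrix.mul_apply, ← Finset.sum_coe_sort S]
  rfl

theorem colsSub_mul_conjTranspose_exchange {i j : Fin N} (hj : j ∈ S) (hi : i ∉ S) :
    colsSub R (insert i (S.erase j)) * (colsSub R (insert i (S.erase j)))ᴴ =
      colsSub R S * (colsSub R S)ᴴ +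
        R.submatrix id ![i, j] * (diagonal (![1, -1] : Fin 2 → ℂ) * Rᴴ.submatrix ![i, j] id) := by
  ext a b
  have hi' : i ∉ S.erase j := fun h => hi (Finset.mem_of_mem_erase h)
  rw [Matrix.add_apply, colsSub_mul_conjTranspose_apply, colsSub_mul_conjTranspose_apply,
    Finset.sum_insert hi', ← Finset.add_sum_erase S _ hj]
  simp only [Matrix.mul_apply (M := R.submatrix _ _), Fin.sum_univ_two, Matrix.diagonal_mul]
  simp
  ring

/-- The determinant of the Gram matrix after a single-column exchange. -/
theorem det_colsSub_exchange {i j : Fin N} (hj : j ∈ S) (hi : i ∉ S)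
    (hdet : IsUnit (colsSub R S * (colsSub R S)ᴴ).det)
    {H : Matrix (Fin N) (Fin N) ℂ} (hH : H = Rᴴ * (colsSub R S * (colsSub R S)ᴴ)⁻¹ * R) :
    (colsSub R (insert i (S.erase j)) * (colsSub R (insert i (S.erase j)))ᴴ).det =
      (colsSub R S * (colsSub R S)ᴴ).det * ((1 + H i i) * (1 - H j j) + H i j * H j i) := by
  rw [colsSub_mul_conjTranspose_exchange R S hj hi, Matrix.det_add_mul _ _ hdet]
  have hsub : Rᴴ.submatrix ![i, j] id * (colsSub R S * (colsSub R S)ᴴ)⁻¹ *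
      R.submatrix id ![i, j] = H.submatrix ![i, j] ![i, j] := by
    rw [hH]
    rfl
  rw [Matrix.mul_assoc (diagonal _), Matrix.mul_assoc (diagonal _), hsub, Matrix.det_fin_two]
  simp only [Matrix.add_apply, Matrix.diagonal_mul, Matrix.submatrix_apply]
  simp [sub_eq_add_neg]

theorem sum_diag_leverage (hdet : IsUnit (colsSub R S * (colsSub R S)ᴴ).det) :
    ∑ j ∈ S, (Rᴴ * (colsSub R S * (colsSub R S)ᴴ)⁻¹ * R) j j = r := by
  have h : ((colsSub R S)ᴴ * (colsSub R S * (colsSub R S)ᴴ)⁻¹ * colsSub R S).trace = r := by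
    rw [Matrix.trace_mul_comm, ← Matrix.mul_assoc, Matrix.mul_nonsing_inv _ hdet]
    simp
  rw [← h, ← Finset.sum_coe_sort S]
  rfl

theorem sum_leverage_mul_leverage (hdet : IsUnit (colsSub R S * (colsSub R S)ᴴ).det)
    {H : Matrix (Fin N) (Fin N) ℂ} (hH : H = Rᴴ * (colsSub R S * (colsSub R S)ᴴ)⁻¹ * R)
    (i : Fin N) : ∑ j ∈ S, H i j * H j i = H i i := by
  set M := (colsSub R S * (colsSub R S)ᴴ)⁻¹ with hM
  have h : (Rᴴ * M * colsSub R S) * ((colsSub R S)ᴴ * M * R) = H := by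
    calc _ = Rᴴ * (M * (colsSub R S * (colsSub R S)ᴴ)) * M * R := by
          simp only [Matrix.mul_assoc]
      _ = H := by rw [hM, Matrix.nonsing_inv_mul _ hdet, Matrix.mul_one, hH]
  conv_rhs => rw [← h]
  rw [Matrix.mul_apply, ← Finset.sum_coe_sort S, hH]
  rfl

/-- For a column set of locally maximal volume, each exterior column has leverage at most
`r / (n - r + 1)`. -/
theorem leverage_le_of_locally_maximal
    (hdet : 0 < (colsSub R S * (colsSub R S)ᴴ).det)
    (hloc : ∀ j ∈ S, ∀ i ∉ S, sqVol R (insert i (S.erase j)) ≤ sqVol R S)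
    {i : Fin N} (hi : i ∉ S) :
    ((S.card : ℝ) - r + 1) * ((Rᴴ * (colsSub R S * (colsSub R S)ᴴ)⁻¹ * R) i i).re ≤ r := by
  have hunit : IsUnit (colsSub R S * (colsSub R S)ᴴ).det := hdet.ne'.isUnit
  obtain ⟨H, hH⟩ : ∃ H, H = Rᴴ * (colsSub R S * (colsSub R S)ᴴ)⁻¹ * R := ⟨_, rfl⟩
  have hle : ∀ j ∈ S, ((1 + H i i) * (1 - H j j) + H i j * H j i).re ≤ 1 := by
    intro j hj
    have h := hloc j hj i hi
    obtain ⟨hre, him⟩ := Complex.pos_iff.mp hdet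
    rw [sqVol, sqVol, det_colsSub_exchange R S hj hi hunit hH, Complex.mul_re, ← him,
      zero_mul, sub_zero] at h
    exact le_of_mul_le_mul_left (by rwa [mul_one]) hre
  have hsum : ∑ j ∈ S, ((1 + H i i) * (1 - H j j) + H i j * H j i) =
      (1 + H i i) * ((S.card : ℂ) - r) + H i i := by
    rw [Finset.sum_add_distrib, sum_leverage_mul_leverage R S hunit hH, ← Finset.mul_sum,
      Finset.sum_sub_distrib, hH, sum_diag_leverage R S hunit]
    simp
  have h := Finset.sum_le_sum hle
  rw [← Complex.re_sum, hsum] at h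
  simp at h
  rw [← hH]
  linarith

theorem posSemidef_mul_conjTranspose_sub_smul {s : ℝ} (hs : 0 ≤ s)
    (hsing : ∀ y : Fin r → ℂ,
      s * Real.sqrt (∑ k, ‖y k‖ ^ 2) ≤ Real.sqrt (∑ j, ‖(y ᵥ* R) j‖ ^ 2)) :
    (R * Rᴴ - ((s ^ 2 : ℝ) : ℂ) • (1 : Matrix (Fin r) (Fin r) ℂ)).PosSemidef := by
  have hnorm : ∀ {m : ℕ} (v : Fin m → ℂ), v ⬝ᵥ star v = ((∑ k, ‖v k‖ ^ 2 : ℝ) : ℂ) := by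
    intro m v
    simp [dotProduct, Complex.mul_conj, Complex.normSq_eq_norm_sq]
  refine .of_dotProduct_mulVec_nonneg ?_ fun x => ?_
  · refine (Matrix.isHermitian_mul_conjTranspose_self R).sub ?_
    simp [Matrix.IsHermitian, Matrix.conjTranspose_smul]
  · have hquad : star x ⬝ᵥ (R * Rᴴ) *ᵥ x = (star x ᵥ* R) ⬝ᵥ star (star x ᵥ* R) := by
      rw [← Matrix.mulVec_mulVec, Matrix.dotProduct_mulVec, Matrix.star_vecMul, star_star]
    have hself : star x ⬝ᵥ x = star x ⬝ᵥ star (star x) := by rw [star_star]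
    rw [Matrix.sub_mulVec, dotProduct_sub, hquad, Matrix.smul_mulVec, Matrix.one_mulVec,
      dotProduct_smul, hself, hnorm, hnorm, smul_eq_mul, ← Complex.ofReal_mul, sub_nonneg,
      Complex.real_le_real]
    have h := pow_le_pow_left₀ (by positivity) (hsing (star x)) 2
    rwa [mul_pow, Real.sq_sqrt (by positivity), Real.sq_sqrt (by positivity)] at h

theorem smul_trace_inv_le_trace_leverage {s : ℝ} (hs : 0 ≤ s)
    (hsing : ∀ y : Fin r → ℂ,
      s * Real.sqrt (∑ k, ‖y k‖ ^ 2) ≤ Real.sqrt (∑ j, ‖(y ᵥ* R) j‖ ^ 2))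
    (hdet : IsUnit (colsSub R S * (colsSub R S)ᴴ).det) :
    s ^ 2 * ((colsSub R S * (colsSub R S)ᴴ)⁻¹).trace.re ≤
      (Rᴴ * (colsSub R S * (colsSub R S)ᴴ)⁻¹ * R).trace.re := by
  set A := colsSub R S
  set M := (A * Aᴴ)⁻¹ with hM
  have hMH : Mᴴ = M := (Matrix.isHermitian_mul_conjTranspose_self A).inv
  have hfac : (M * A) * (M * A)ᴴ = M := by
    rw [Matrix.conjTranspose_mul, hMH, Matrix.mul_assoc, ← Matrix.mul_assoc A, hM,
      Matrix.mul_nonsing_inv _ hdet, Matrix.mul_one]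
  have h := ((posSemidef_mul_conjTranspose_sub_smul R hs hsing).conjTranspose_mul_mul_same
    (M * A)).trace_nonneg
  rw [Matrix.trace_mul_comm, ← Matrix.mul_assoc, hfac, Matrix.mul_sub, Matrix.trace_sub,
    Matrix.mul_smul, Matrix.mul_one, Matrix.trace_smul, ← Matrix.mul_assoc,
    Matrix.trace_mul_comm, ← Matrix.mul_assoc] at h
  have hre := (Complex.nonneg_iff.mp h).1
  rw [Complex.sub_re, smul_eq_mul, Complex.re_ofReal_mul] at hre
  linarith

end

/-- If the smallest singular value of `R` is at least `s > 0` (i.e. `‖yR‖₂ ≥ s‖y‖₂` for all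
`y`) and `Â = R_{:,S}` is an `r × n` column submatrix of nonzero volume with locally maximal
volume under single-column exchanges, then `Â Âᴴ` is invertible and
`trace((Â Âᴴ)⁻¹) ≤ (r + r(N−n)/(n−r+1))/s²`, i.e.
`‖Â⁺‖_F ≤ ‖R⁺‖₂ √(r + r(N−n)/(n−r+1))`. -/
theorem statement14 (r n N : ℕ) (hrn : r ≤ n) (hnN : n ≤ N)
    (R : Matrix (Fin r) (Fin N) ℂ) (s : ℝ) (hs : 0 < s)
    (hsing : ∀ y : Fin r → ℂ,
      s * Real.sqrt (∑ k, ‖y k‖ ^ 2) ≤ Real.sqrt (∑ j, ‖(y ᵥ* R) j‖ ^ 2))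
    (S : Finset (Fin N)) (hS : S.card = n)
    (hvol : sqVol R S ≠ 0)
    (hloc : ∀ j ∈ S, ∀ i ∉ S, sqVol R (insert i (S.erase j)) ≤ sqVol R S) :
    IsUnit (colsSub R S * (colsSub R S)ᴴ).det ∧
      ((colsSub R S * (colsSub R S)ᴴ)⁻¹).trace.re
        ≤ ((r : ℝ) + (r : ℝ) * ((N : ℝ) - (n : ℝ)) / ((n : ℝ) - (r : ℝ) + 1)) / s ^ 2 := by
  have hposdet : 0 < (colsSub R S * (colsSub R S)ᴴ).det := by
    have hps := Matrix.posSemidef_self_mul_conjTranspose (colsSub R S)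
    refine lt_of_le_of_ne hps.det_nonneg fun h => hvol ?_
    rw [sqVol, ← h, Complex.zero_re]
  have hunit : IsUnit (colsSub R S * (colsSub R S)ᴴ).det := hposdet.ne'.isUnit
  refine ⟨hunit, ?_⟩
  have hden : (0 : ℝ) < (n : ℝ) - r + 1 := by
    have : (r : ℝ) ≤ n := by exact_mod_cast hrn
    linarith
  rw [le_div_iff₀ (by positivity), mul_comm]
  refine (smul_trace_inv_le_trace_leverage R S hs.le hsing hunit).trans ?_
  rw [Matrix.trace, ← Finset.sum_add_sum_compl S, Complex.add_re]
  simp only [Matrix.diag_apply]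
  rw [sum_diag_leverage R S hunit, Complex.natCast_re, Complex.re_sum]
  gcongr
  have hbound : ∀ i ∈ Sᶜ, ((Rᴴ * (colsSub R S * (colsSub R S)ᴴ)⁻¹ * R) i i).re ≤
      r / ((n : ℝ) - r + 1) := by
    intro i hi
    rw [le_div_iff₀ hden, mul_comm, ← hS]
    exact leverage_le_of_locally_maximal R S hposdet hloc (Finset.mem_compl.mp hi)
  refine (Finset.sum_le_card_nsmul _ _ _ hbound).trans_eq ?_
  rw [Finset.card_compl, Fintype.card_fin, hS, nsmul_eq_mul, Nat.cast_sub hnN]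
  ring
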